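/- Consider a strided-well-defined processing chain with receptive field size B, layers L, dimensionality reduction constants c_j, strides k_j and stride products k_j*. Let D ∈ ℕ₊ with D ≥ B be such that k_L* divides D − B + 1, let ξ ∈ M₀^D, and for j ∈ {0,…,L} let u_j := dim(EvalStride_j(Subsignal_B(ξ, i))) (independent of i). Then for all j ∈ {0,…,L}, all subsignal indices i ∈ {1,…,D−B+1} and all sample indices μ ∈ {1,…,u_j}: EvalStride_j(Subsignal_B(ξ, i))_μ = EvalSlide_j(ξ)_{⌊(i−1)/k_j*⌋+μ, ((i−1) mod k_j*)+1}. -/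

import Mathlib

namespace Scan

universe u v

/-- Extraction of the subsignal of length `d` starting at (0-based) index `i`. -/
def subsig {M : Type*} {D : ℕ} (d i : ℕ) (ξ : Fin D → M) (h : i + d ≤ D) : Fin d → M :=
  fun ν => ξ ⟨i + ν.val, by have := ν.isLt; omega⟩

/-- Application of a function in a sliding fashion. -/
def slide {M N : Type*} {c : ℕ} (f : (Fin c → M) → N) {D : ℕ} (ξ : Fin D → M) :
    Fin (D + 1 - c) → N :=
  fun i => f (subsig c i.val ξ (by have := i.isLt; omega))

/-- Application of a function in a strided fashion (to non-overlapping blocks). -/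
def strideApp {M N : Type*} {k : ℕ} (g : (Fin k → M) → N) {D : ℕ} (ξ : Fin D → M) :
    Fin (D / k) → N :=
  fun i => g (subsig k (k * i.val) ξ (by
    have h1 : k * (i.val + 1) ≤ k * (D / k) := Nat.mul_le_mul_left k i.isLt
    have h2 : (D / k) * k ≤ D := Nat.div_mul_le_self D k
    have h3 : k * (D / k) = (D / k) * k := Nat.mul_comm _ _
    have h4 : k * (i.val + 1) = k * i.val + k := Nat.mul_succ k i.val
    omega))

/-- `T` is a subsignal compatible transformation with dimensionality reduction
constant `c` (the dimensionality reduction property is encoded in the type of `T`;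
this predicate is the exchange property, stated sample-wise). -/
def IsSCT {M N : Type*} (c : ℕ) (T : ∀ D : ℕ, (Fin D → M) → Fin (D + 1 - c) → N) : Prop :=
  ∀ (d D : ℕ), c ≤ d → ∀ (ξ : Fin D → M) (i : ℕ) (h : i + d ≤ D),
    ∀ ν : Fin (d + 1 - c),
      T d (subsig d i ξ h) ν = T D ξ ⟨i + ν.val, by have := ν.isLt; omega⟩

/-- Vectorization operator. -/
def vec {M : Type*} {a b : ℕ} (ξ : Fin a → Fin b → M) : Fin (a * b) → M :=
  fun j => ξ
    ⟨j.val % a, by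
      rcases Nat.eq_zero_or_pos a with h | h
      · exact absurd j.isLt (by simp [h])
      · exact Nat.mod_lt _ h⟩
    ⟨j.val / a, Nat.div_lt_of_lt_mul j.isLt⟩

/-- Inverse vectorization operator. -/
def vecInv {M : Type*} (a b : ℕ) (ξ : Fin (a * b) → M) : Fin a → Fin b → M :=
  fun i j => ξ ⟨j.val * a + i.val, by
    have h1 : j.val * a + i.val < j.val * a + a := Nat.add_lt_add_left i.isLt _
    have h2 : j.val * a + a ≤ b * a := by
      calc j.val * a + a = (j.val + 1) * a := by ring
        _ ≤ b * a := Nat.mul_le_mul_right a j.isLt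
    calc j.val * a + i.val < j.val * a + a := h1
      _ ≤ b * a := h2
      _ = a * b := Nat.mul_comm b a⟩

/-- Matrix transpose. -/
def mtrans {M : Type*} {a b : ℕ} (ξ : Fin a → Fin b → M) : Fin b → Fin a → M :=
  fun j i => ξ i j

/-- The fragmentation operator. -/
def frag {M : Type*} (k : ℕ) {q s : ℕ} (ξ : Fin (k * q) → Fin s → M) :
    Fin q → Fin (k * s) → M :=
  mtrans (vecInv (k * s) q (fun j => vec (mtrans ξ) (Fin.cast (by ring) j)))

/-- The defragmentation operator. -/
def defrag {M : Type*} (k : ℕ) {q s : ℕ} (ξ : Fin q → Fin (k * s) → M) :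
    Fin (k * q) → Fin s → M :=
  mtrans (vecInv s (k * q) (fun j => vec (mtrans ξ) (Fin.cast (by ring) j)))

/-- Fragmentation of a matrix with an arbitrary number `r` of rows (the operator
agrees with `frag` whenever `k ∣ r`, which is guaranteed by the well-definedness
requirements of a processing chain). -/
def fragD {M : Type*} (k : ℕ) {r s : ℕ} (ξ : Fin r → Fin s → M) :
    Fin (r / k) → Fin (k * s) → M :=
  frag k (fun (i : Fin (k * (r / k))) j =>
    ξ (Fin.castLE (by
      calc k * (r / k) = (r / k) * k := Nat.mul_comm _ _
        _ ≤ r := Nat.div_mul_le_self r k) i) j)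

/-- The stride products `k_j* = ∏_{ν=1}^j k_ν` of a processing chain. -/
def kstar (k : ℕ → ℕ) (j : ℕ) : ℕ := ∏ ν ∈ Finset.range j, k ν

section Chain

variable (M : ℕ → Type u) (Nt : ℕ → Type v) (c k : ℕ → ℕ)
  (T : ∀ j : ℕ, ∀ Dq : ℕ, (Fin Dq → M j) → Fin (Dq + 1 - c j) → Nt j)
  (g : ∀ j : ℕ, (Fin (k j) → Nt j) → M (j + 1))

/-- Application of a processing chain in a strided fashion (`EvalStride`);
layer `j+1` of the paper corresponds to the data `T j`, `g j`, `c j`, `k j`. -/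
def evalStride (B : ℕ) : (j : ℕ) → (ρ : Fin B → M 0) → Σ q : ℕ, Fin q → M j
  | 0, ρ => ⟨B, ρ⟩
  | j + 1, ρ =>
    let p := evalStride B j ρ
    ⟨(p.1 + 1 - c j) / k j, strideApp (g j) (T j p.1 p.2)⟩

/-- Application of a processing chain in a sliding fashion (`EvalSlide`), producing
a fragmented signal, encoded as `⟨rows, cols, matrix⟩`; the subsignal compatible
transformation `T j` and the sliding application of `g j` act on each fragment
(column) independently, followed by fragmentation. -/
def evalSlide (D : ℕ) : (j : ℕ) → (ξ : Fin D → M 0) → Σ r : ℕ, Σ s : ℕ, Fin r → Fin s → M j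
  | 0, ξ => ⟨D, 1, fun i _ => ξ i⟩
  | j + 1, ξ =>
    let p := evalSlide D j ξ
    let A : Fin (p.1 + 1 - c j) → Fin p.2.1 → Nt j :=
      fun i col => T j p.1 (fun i' => p.2.2 i' col) i
    let Bm : Fin ((p.1 + 1 - c j) + 1 - k j) → Fin p.2.1 → M (j + 1) :=
      fun i col => slide (g j) (fun i' => A i' col) i
    ⟨((p.1 + 1 - c j) + 1 - k j) / k j, k j * p.2.1, fragD (k j) Bm⟩

/-- A processing chain is strided-well-defined if in every layer the stride `k j`
divides the dimensionality of `T j (EvalStride_j ρ)` and the resulting signal is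
non-empty. -/
def StridedWellDefined (B L : ℕ) : Prop :=
  ∀ j, j < L → ∀ ρ : Fin B → M 0,
    (k j ∣ ((evalStride M Nt c k T g B j ρ).1 + 1 - c j)) ∧
    0 < (evalStride M Nt c k T g B (j + 1) ρ).1

lemma kstar_succ (k : ℕ → ℕ) (j : ℕ) : kstar k (j + 1) = kstar k j * k j :=
  Finset.prod_range_succ k j

lemma kstar_pos {k : ℕ → ℕ} {L : ℕ} (hk : ∀ j, j < L → 0 < k j) {j : ℕ} (hj : j ≤ L) :
    0 < kstar k j :=
  Finset.prod_pos fun ν hν => hk ν (by have := Finset.mem_range.mp hν; omega)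

lemma kstar_dvd_kstar (k : ℕ → ℕ) {j L : ℕ} (hj : j ≤ L) : kstar k j ∣ kstar k L :=
  Finset.prod_dvd_prod_of_subset _ _ _ (Finset.range_mono hj)

/-- A matrix entry only depends on the values of its indices. -/
lemma apply_eq_of_val_eq {M : Type*} {a b : ℕ} (f : Fin a → Fin b → M) {x x' : Fin a}
    {y y' : Fin b} (hx : x.val = x'.val) (hy : y.val = y'.val) : f x y = f x' y' := by
  rw [Fin.ext hx, Fin.ext hy]

/-- Entries of a fragmented matrix in terms of entries of the original matrix. -/
lemma fragD_apply {M : Type*} (k : ℕ) {r s : ℕ} (ξ : Fin r → Fin s → M) (a : Fin (r / k))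
    (b : Fin (k * s)) {x : Fin r} {y : Fin s} (hx : x.val = (a.val * (k * s) + b.val) / s)
    (hy : y.val = (a.val * (k * s) + b.val) % s) : fragD k ξ a b = ξ x y :=
  apply_eq_of_val_eq ξ hx.symm hy.symm

/-- Dimensions of the strided and the sliding application of a processing chain. -/
lemma evalStride_evalSlide_dim {B L D : ℕ} (hk : ∀ j, j < L → 0 < k j)
    (hwd : StridedWellDefined M Nt c k T g B L) (hD : B ≤ D)
    (hdiv : kstar k L ∣ (D - B + 1)) (ξ : Fin D → M 0) (ρ : Fin B → M 0) :
    ∀ j, j ≤ L → (evalStride M Nt c k T g B j ρ).1 + (D - B + 1) / kstar k j =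
        (evalSlide M Nt c k T g D j ξ).1 + 1 ∧
      (evalSlide M Nt c k T g D j ξ).2.1 = kstar k j := by
  intro j
  induction j with
  | zero =>
    intro _
    refine ⟨?_, rfl⟩
    simp only [evalStride, evalSlide, kstar, Finset.range_zero, Finset.prod_empty, Nat.div_one]
    omega
  | succ j ih =>
    intro hj
    obtain ⟨hr, hs⟩ := ih (by omega)
    obtain ⟨⟨u', hu'⟩, hpos⟩ := hwd j hj ρ
    refine ⟨?_, ?_⟩
    · have hkj := hk j hj
      obtain ⟨m, hm⟩ := (kstar_dvd_kstar k hj).trans hdiv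
      have hm0 : 0 < m := Nat.pos_of_ne_zero (by rintro rfl; simp at hm)
      have e2 : (D - B + 1) / kstar k (j + 1) = m := by
        rw [hm, Nat.mul_div_cancel_left _ (kstar_pos hk hj)]
      have e1 : (D - B + 1) / kstar k j = k j * m := by
        rw [hm, kstar_succ, mul_assoc, Nat.mul_div_cancel_left _ (kstar_pos hk (by omega))]
      rw [e1] at hr
      rw [e2]
      change 0 < (_ + 1 - c j) / k j at hpos
      change (_ + 1 - c j) / k j + m = ((_ + 1 - c j) + 1 - k j) / k j + 1
      rw [hu', Nat.mul_div_cancel_left _ hkj] at hpos ⊢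
      obtain ⟨n, rfl⟩ := Nat.exists_eq_add_of_lt hm0
      have hku : 0 < k j * u' := Nat.mul_pos hkj hpos
      have e3 : (evalSlide M Nt c k T g D j ξ).1 + 1 - c j + 1 - k j = k j * (u' + n) := by
        rw [mul_add] at hr ⊢
        simp only [zero_add, mul_one] at hr
        omega
      rw [e3, Nat.mul_div_cancel_left _ hkj]
      omega
    · change k j * _ = _
      rw [hs, kstar_succ, mul_comm]

/-- the outcome of the strided application of a processing chain on
any subsignal occurs inside the fragmented result of the sliding application on
the entire signal.  In 0-based indexing (paper index `i` becomes `i + 1`), for all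
layers `j ≤ L`, subsignal indices `i` and sample indices `μ`:
`EvalStride_j(Subsignal_B(ξ, i))_μ = EvalSlide_j(ξ)_{⌊i/k_j*⌋ + μ, i mod k_j*}`. -/
theorem evalStride_in_evalSlide (M : ℕ → Type u) (Nt : ℕ → Type v) (c k : ℕ → ℕ)
    (T : ∀ j : ℕ, ∀ Dq : ℕ, (Fin Dq → M j) → Fin (Dq + 1 - c j) → Nt j)
    (g : ∀ j : ℕ, (Fin (k j) → Nt j) → M (j + 1))
    (B L : ℕ) (hB : 0 < B) (hL : 0 < L)
    (hc : ∀ j, j < L → 0 < c j) (hk : ∀ j, j < L → 0 < k j)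
    (hT : ∀ j, j < L → IsSCT (c j) (T j))
    (hwd : StridedWellDefined M Nt c k T g B L)
    (D : ℕ) (hD : B ≤ D) (hdiv : kstar k L ∣ (D - B + 1))
    (ξ : Fin D → M 0) :
    ∀ j, j ≤ L → ∀ (i : ℕ) (hiB : i + B ≤ D) (μ : ℕ)
      (h1 : μ < (evalStride M Nt c k T g B j (subsig B i ξ hiB)).1)
      (h2 : i / kstar k j + μ < (evalSlide M Nt c k T g D j ξ).1)
      (h3 : i % kstar k j < (evalSlide M Nt c k T g D j ξ).2.1),
      (evalStride M Nt c k T g B j (subsig B i ξ hiB)).2 ⟨μ, h1⟩ =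
        (evalSlide M Nt c k T g D j ξ).2.2 ⟨i / kstar k j + μ, h2⟩ ⟨i % kstar k j, h3⟩ := by
  intro j
  induction j with
  | zero =>
    intro _ i hiB μ h1 h2 h3
    simp [evalStride, evalSlide, subsig, kstar]
  | succ j ih =>
    intro hj i hiB μ h1 h2 h3
    have hjL : j < L := hj
    obtain ⟨hr, hs⟩ := evalStride_evalSlide_dim M Nt c k T g hk hwd hD hdiv ξ
      (subsig B i ξ hiB) j hjL.le
    obtain ⟨⟨u', hu'⟩, -⟩ := hwd j hjL (subsig B i ξ hiB)
    have hkj := hk j hjL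
    have hks := kstar_pos hk hjL.le
    replace ih := ih hjL.le i hiB
    have hq : i / kstar k j < (D - B + 1) / kstar k j :=
      Nat.div_lt_div_of_lt_of_dvd ((kstar_dvd_kstar k hjL.le).trans hdiv) (by omega)
    have hcol : i % kstar k j < (evalSlide M Nt c k T g D j ξ).2.1 :=
      hs.symm ▸ Nat.mod_lt i hks
    have hle : i / kstar k j + (evalStride M Nt c k T g B j (subsig B i ξ hiB)).1 ≤
        (evalSlide M Nt c k T g D j ξ).1 := by omega
    change μ < (_ + 1 - c j) / k j at h1
    have hμ : k j * μ + k j ≤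
        (evalStride M Nt c k T g B j (subsig B i ξ hiB)).1 + 1 - c j := by
      rw [hu', Nat.mul_div_cancel_left _ hkj] at h1
      rw [hu', ← Nat.mul_succ]
      exact Nat.mul_le_mul_left _ h1
    have hsub : (evalStride M Nt c k T g B j (subsig B i ξ hiB)).2 =
        subsig _ (i / kstar k j)
          (fun a => (evalSlide M Nt c k T g D j ξ).2.2 a ⟨i % kstar k j, hcol⟩) hle := by
      funext ν
      exact ih ν.val ν.isLt (by omega) hcol
    have hidx : (i / kstar k (j + 1) + μ) * (k j * kstar k j) + i % kstar k (j + 1) =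
        i + kstar k j * (k j * μ) := by
      have := Nat.div_add_mod i (kstar k (j + 1))
      rw [kstar_succ] at this ⊢
      linear_combination this
    have hrow : i / kstar k j + k j * μ <
        (evalSlide M Nt c k T g D j ξ).1 + 1 - c j + 1 - k j := by omega
    refine Eq.trans ?_ (fragD_apply (k j) (fun a col => slide (g j)
      (fun a' => T j _ (fun b => (evalSlide M Nt c k T g D j ξ).2.2 b col) a') a)
      ⟨_, h2⟩ ⟨_, h3⟩ (x := ⟨i / kstar k j + k j * μ, hrow⟩)
      (y := ⟨i % kstar k j, hcol⟩) ?_ ?_).symm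
    · change g j _ = g j _
      congr 1
      funext ν
      change T j _ (evalStride M Nt c k T g B j (subsig B i ξ hiB)).2
        ⟨k j * μ + ν.val, by omega⟩ = T j _ _ ⟨i / kstar k j + k j * μ + ν.val, by omega⟩
      rw [hsub, hT j hjL _ _ (by omega)]
      congr 2
      exact (add_assoc _ _ _).symm
    · change i / kstar k j + k j * μ =
        ((i / kstar k (j + 1) + μ) * (k j * _) + i % kstar k (j + 1)) / _
      rw [hs, hidx, Nat.add_mul_div_left _ _ hks]
    · change i % kstar k j =
        ((i / kstar k (j + 1) + μ) * (k j * _) + i % kstar k (j + 1)) % _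
      rw [hs, hidx, Nat.add_mul_mod_self_left]

end Chain

end Scan
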